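/- arXiv:2312.02426 — 2 statements merged into one kernel-verified Lean document; each statement's English description precedes it below -/
import Mathlib

section
/- Let n ≥ 0, let b be an odd integer with b > 4n + 1, and let A = {1, b, b + 1}. Let S ∈ {0,1}^{b+1} be the seed determined by: w^{A,S}(−m) = 0 if and only if m is a positive multiple of 4 with m ≤ 4n (i.e. S is the string (0111)^n padded with leading 1's). Then per(A, S) = 2(n + 1)b + 1 and preper(A, S) = 0. -/
open Classical in
/-- The winning sequence on ℕ, where `seed` gives values at negative positions. -/
noncomputable def subW (A : Set ℕ) (seed : ℤ → ℕ) : ℕ → ℕ := fun n =>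
  Nat.strongRecOn n (fun n ih =>
    if ∃ x ∈ A, (if h : 0 < x ∧ x ≤ n then ih (n - x) (by omega)
                 else seed ((n : ℤ) - (x : ℤ))) = 0
    then 1 else 0)

/-- The winning sequence `w^{A,seed} : ℤ → ℕ`. -/
noncomputable def W (A : Set ℕ) (seed : ℤ → ℕ) : ℤ → ℕ := fun n =>
  if 0 ≤ n then subW A seed n.toNat else seed n

/-- The trivial seed (all ones), giving the unseeded sequence `w^A`. -/
def one : ℤ → ℕ := fun _ => 1

/-- The seed function determined by a string `S ∈ {0,1}^L`: `w(-i) = S_i` for `1 ≤ i ≤ L`,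
and `w(n) = 1` for `n < -L`. -/
def seedExt (L : ℕ) (S : ℕ → Bool) : ℤ → ℕ := fun j =>
  if -(L : ℤ) ≤ j ∧ j < 0 then (if S ((-j).toNat - 1) then 1 else 0) else 1

/-- `w` is eventually periodic over `p`. -/
def PeriodicOver (w : ℤ → ℕ) (p : ℕ) : Prop :=
  ∃ N : ℕ, ∀ n : ℤ, (N : ℤ) ≤ n → w n = w (n + p)

/-- The (eventual) period: the least `p ≥ 1` over which `w` is eventually periodic. -/
noncomputable def per (w : ℤ → ℕ) : ℕ := sInf {p : ℕ | 0 < p ∧ PeriodicOver w p}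

/-- The preperiod: the least `N` that works for `p = per w`. -/
noncomputable def preper (w : ℤ → ℕ) : ℕ :=
  sInf {N : ℕ | ∀ n : ℤ, (N : ℤ) ≤ n → w n = w (n + per w)}

open Classical in
/-- The seed of Statement 18: `w(-m) = 0` iff `m` is a positive multiple of `4`
with `m ≤ 4n`, i.e. the string `(0111)^n` padded with leading 1's. -/
noncomputable def seed18 (n : ℕ) : ℤ → ℕ := fun j =>
  if ∃ m : ℕ, 1 ≤ m ∧ m ≤ n ∧ j = -(4 * (m : ℤ)) then 0 else 1

open Classical in
lemma subW_eq (A : Set ℕ) (seed : ℤ → ℕ) (hA : ∀ x ∈ A, 0 < x) (n : ℕ) :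
    subW A seed n = if ∃ x ∈ A, W A seed ((n : ℤ) - x) = 0 then 1 else 0 := by
  have key : ∀ x ∈ A, (if 0 < x ∧ x ≤ n then subW A seed (n - x)
      else seed ((n : ℤ) - (x : ℤ))) = W A seed ((n : ℤ) - x) := by
    intro x hx
    have hx0 := hA x hx
    by_cases h : x ≤ n
    · have h' : ((n : ℤ) - x).toNat = n - x := by omega
      rw [if_pos ⟨hx0, h⟩, W, if_pos (by omega), h']
    · rw [if_neg (by tauto), W, if_neg (by omega)]
  have hiff : (∃ x ∈ A, W A seed ((n : ℤ) - x) = 0) ↔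
      ∃ x ∈ A, (if 0 < x ∧ x ≤ n then subW A seed (n - x)
        else seed ((n : ℤ) - (x : ℤ))) = 0 :=
    exists_congr fun x => and_congr_right fun hx => by rw [key x hx]
  rw [if_congr hiff rfl rfl]
  conv_lhs => rw [subW, Nat.strongRecOn_eq]
  rfl

open Classical in
/-- The recurrence determining the winning sequence at nonnegative positions. -/
lemma W_eq_of_nonneg (A : Set ℕ) (seed : ℤ → ℕ) (hA : ∀ x ∈ A, 0 < x) {m : ℤ} (hm : 0 ≤ m) :
    W A seed m = if ∃ x ∈ A, W A seed (m - x) = 0 then 1 else 0 := by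
  lift m to ℕ using hm
  rw [W, if_pos (Int.natCast_nonneg m), Int.toNat_natCast, subW_eq A seed hA]

/-- The circumference of a circle tiled by `B` blocks of length `2k` followed by `k - 1` blocks of
length `2k - 1`. -/
def circumference (k B : ℤ) : ℤ := 2 * k * B + (2 * k - 1) * (k - 1)

/-- The offset of the position `y` within its block, on the circle tiled by `B` blocks of length
`2k` followed by `k - 1` blocks of length `2k - 1`. -/
def blockOffset (k B y : ℤ) : ℤ :=
  if y % circumference k B < 2 * k * B then y % circumference k B % (2 * k)
  else (y % circumference k B - 2 * k * B) % (2 * k - 1)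

/-- The positions on the circle at even offset at most `k - 2` within their block. -/
def IsBlockZero (k B y : ℤ) : Prop := Even (blockOffset k B y) ∧ blockOffset k B y ≤ k - 2

section

variable {k B : ℤ}

lemma circumference_pos (hk : 2 ≤ k) (hB : 1 ≤ B) : 0 < circumference k B := by
  unfold circumference; nlinarith [mul_pos (show 0 < k by omega) (show 0 < B by omega)]

lemma blockOffset_add_mul (y j : ℤ) :
    blockOffset k B (y + circumference k B * j) = blockOffset k B y := by
  simp only [blockOffset, Int.add_mul_emod_self_left]

lemma isBlockZero_add_mul (y j : ℤ) :
    IsBlockZero k B (y + circumference k B * j) ↔ IsBlockZero k B y := by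
  simp only [IsBlockZero, blockOffset_add_mul]

lemma blockOffset_long (hk : 2 ≤ k) {q u : ℤ} (hq : 0 ≤ q) (hqB : q < B) (hu : 0 ≤ u)
    (huk : u < 2 * k) : blockOffset k B (2 * k * q + u) = u := by
  have h1 : 2 * k * q + u < 2 * k * B := by nlinarith
  have h2 : 0 ≤ 2 * k * q + u := by positivity
  have h3 : 2 * k * B ≤ circumference k B := by unfold circumference; nlinarith
  rw [blockOffset, Int.emod_eq_of_lt h2 (h1.trans_le h3), if_pos h1, Int.mul_add_emod_self_left,
    Int.emod_eq_of_lt hu huk]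

lemma blockOffset_short (hk : 2 ≤ k) (hB : 0 ≤ B) {q u : ℤ} (hq : 0 ≤ q) (hqk : q < k - 1)
    (hu : 0 ≤ u) (huk : u < 2 * k - 1) :
    blockOffset k B (2 * k * B + ((2 * k - 1) * q + u)) = u := by
  have h0 : 0 ≤ (2 * k - 1) * q := mul_nonneg (by omega) hq
  have h1 : 0 ≤ 2 * k * B := by positivity
  have h2 : 2 * k * B + ((2 * k - 1) * q + u) < circumference k B := by
    unfold circumference; nlinarith
  rw [blockOffset, Int.emod_eq_of_lt (by omega) h2, if_neg (by omega), add_sub_cancel_left,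
    Int.mul_add_emod_self_left, Int.emod_eq_of_lt hu huk]

lemma exists_block (hk : 2 ≤ k) (hB : 1 ≤ B) (y : ℤ) :
    ∃ j q u : ℤ, 0 ≤ q ∧ 0 ≤ u ∧
      ((q < B ∧ u < 2 * k ∧ y = 2 * k * q + u + circumference k B * j) ∨
       (q < k - 1 ∧ u < 2 * k - 1 ∧
        y = 2 * k * B + ((2 * k - 1) * q + u) + circumference k B * j)) := by
  have hP := circumference_pos hk hB
  have hy := Int.emod_add_mul_ediv y (circumference k B)
  have h0 := Int.emod_nonneg y hP.ne'
  have h1 := Int.emod_lt_of_pos y hP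
  generalize y % circumference k B = r at *
  by_cases hr : r < 2 * k * B
  · have := Int.emod_add_mul_ediv r (2 * k)
    refine ⟨y / circumference k B, r / (2 * k), r % (2 * k), Int.ediv_nonneg h0 (by omega),
      Int.emod_nonneg _ (by omega), .inl ⟨?_, Int.emod_lt_of_pos _ (by omega), by omega⟩⟩
    exact Int.ediv_lt_of_lt_mul (by omega) (by linarith)
  · have := Int.emod_add_mul_ediv (r - 2 * k * B) (2 * k - 1)
    refine ⟨y / circumference k B, (r - 2 * k * B) / (2 * k - 1), (r - 2 * k * B) % (2 * k - 1),
      Int.ediv_nonneg (by omega) (by omega), Int.emod_nonneg _ (by omega),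
      .inr ⟨?_, Int.emod_lt_of_pos _ (by omega), by omega⟩⟩
    refine Int.ediv_lt_of_lt_mul (by omega) ?_
    unfold circumference at h1; linarith

lemma blockOffset_nonneg (hk : 2 ≤ k) (hB : 1 ≤ B) (y : ℤ) : 0 ≤ blockOffset k B y := by
  obtain ⟨j, q, u, hq, hu, ⟨hq', hu', rfl⟩ | ⟨hq', hu', rfl⟩⟩ := exists_block hk hB y
  · rwa [blockOffset_add_mul, blockOffset_long hk hq hq' hu hu']
  · rwa [blockOffset_add_mul, blockOffset_short hk (by omega) hq hq' hu hu']

lemma blockOffset_add_one (hk : 2 ≤ k) (hB : 1 ≤ B) (y : ℤ) :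
    blockOffset k B (y + 1) = blockOffset k B y + 1 ∧ blockOffset k B y < 2 * k - 1 ∨
    blockOffset k B (y + 1) = 0 ∧
      (blockOffset k B y = 2 * k - 1 ∨ blockOffset k B y = 2 * k - 2) := by
  obtain ⟨j, q, u, hq, hu, ⟨hq', hu', rfl⟩ | ⟨hq', hu', rfl⟩⟩ := exists_block hk hB y
  · rw [add_right_comm, blockOffset_add_mul, blockOffset_add_mul,
      blockOffset_long hk hq hq' hu hu', add_assoc]
    rcases (show u + 1 < 2 * k ∨ u = 2 * k - 1 by omega) with h | rfl
    · left
      rw [blockOffset_long hk hq hq' (by omega) h]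
      omega
    · refine .inr ⟨?_, .inl rfl⟩
      rcases (show q + 1 < B ∨ B = q + 1 by omega) with h | rfl
      · rw [show 2 * k * q + (2 * k - 1 + 1) = 2 * k * (q + 1) + 0 by ring]
        exact blockOffset_long hk (by omega) h le_rfl (by omega)
      · rw [show 2 * k * q + (2 * k - 1 + 1) = 2 * k * (q + 1) + ((2 * k - 1) * 0 + 0) by ring]
        exact blockOffset_short hk (by omega) le_rfl (by omega) le_rfl (by omega)
  · rw [add_right_comm, blockOffset_add_mul, blockOffset_add_mul,
      blockOffset_short hk (by omega) hq hq' hu hu', add_assoc, add_assoc]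
    rcases (show u + 1 < 2 * k - 1 ∨ u = 2 * k - 2 by omega) with h | rfl
    · left
      rw [blockOffset_short hk (by omega) hq hq' (by omega) h]
      omega
    · refine .inr ⟨?_, .inr rfl⟩
      rcases (show q + 1 < k - 1 ∨ k = q + 2 by omega) with h | rfl
      · rw [show (2 * k - 1) * q + (2 * k - 2 + 1) = (2 * k - 1) * (q + 1) + 0 by ring]
        exact blockOffset_short hk (by omega) (by omega) h le_rfl (by omega)
      · rw [show 2 * (q + 2) * B + ((2 * (q + 2) - 1) * q + (2 * (q + 2) - 2 + 1)) =
          2 * (q + 2) * 0 + 0 + circumference (q + 2) B * 1 by unfold circumference; ring,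
          blockOffset_add_mul]
        exact blockOffset_long hk le_rfl (by omega) le_rfl (by omega)

lemma blockOffset_sub (hk : 2 ≤ k) (hB : 1 ≤ B) (y : ℤ) (j : ℕ) (hj : j ≤ blockOffset k B y) :
    blockOffset k B (y - j) = blockOffset k B y - j := by
  induction j with
  | zero => simp
  | succ j ih =>
    have ih := ih (by push_cast at hj; omega)
    have h := blockOffset_add_one hk hB (y - (j + 1 : ℕ))
    rw [show y - ((j + 1 : ℕ) : ℤ) + 1 = y - j by push_cast; ring, ih] at h
    push_cast at hj h ⊢
    omega

lemma blockOffset_sub_of_lt (hk : 2 ≤ k) (hB : 1 ≤ B) (y : ℤ) (j : ℤ)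
    (hj : blockOffset k B y < j) (hjk : j < blockOffset k B y + 2 * k) :
    blockOffset k B (y - j) = blockOffset k B y - j + 2 * k ∨
      blockOffset k B (y - j) = blockOffset k B y - j + 2 * k - 1 := by
  have h0 := blockOffset_nonneg hk hB y
  lift blockOffset k B y to ℕ using h0 with u hu
  have h1 := blockOffset_sub hk hB y u hu.le
  have h2 := blockOffset_add_one hk hB (y - u - 1)
  rw [sub_add_cancel, h1] at h2
  obtain ⟨i, rfl⟩ : ∃ i : ℕ, j = u + 1 + i := ⟨(j - u - 1).toNat, by omega⟩
  have h4 := blockOffset_nonneg hk hB (y - u - 1)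
  have h3 := blockOffset_sub hk hB (y - u - 1) i (by omega)
  rw [show y - (u + 1 + i) = y - u - 1 - i by ring, h3]
  omega

/-- The block zeros satisfy the recurrence of the `{1, b, b + 1}`-subtraction game in the
coordinate `y = k x`, where `k b = -1` on the circle. -/
lemma isBlockZero_iff (hk : 2 ≤ k) (hke : Even k) (hB : 1 ≤ B) (y : ℤ) :
    IsBlockZero k B y ↔ ¬ IsBlockZero k B (y - k) ∧ ¬ IsBlockZero k B (y + 1) ∧
      ¬ IsBlockZero k B (y - (k - 1)) := by
  have h0 := blockOffset_nonneg hk hB y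
  have h1 := blockOffset_add_one hk hB y
  have h2 (j : ℤ) (hj0 : 0 ≤ j) (hj : j ≤ blockOffset k B y) :
      blockOffset k B (y - j) = blockOffset k B y - j := by
    lift j to ℕ using hj0
    exact blockOffset_sub hk hB y j hj
  have h3 := h2 k (by omega)
  have h4 := h2 (k - 1) (by omega)
  have h5 := blockOffset_sub_of_lt hk hB y k
  have h6 := blockOffset_sub_of_lt hk hB y (k - 1)
  simp only [IsBlockZero, Int.even_iff] at *
  omega

lemma isBlockZero_of_mem_first (hk : 2 ≤ k) (hB : 1 ≤ B) {u : ℤ} (hu : 0 ≤ u) (hue : Even u)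
    (huk : u ≤ k - 2) : IsBlockZero k B u ∧ IsBlockZero k B (u + 2 * k) ∧
      IsBlockZero k B (u - (2 * k - 1)) := by
  have h1 : blockOffset k B u = u := by
    have := blockOffset_long (B := B) hk le_rfl (by omega) hu (by omega)
    rwa [mul_zero, zero_add] at this
  have h2 : blockOffset k B (u + 2 * k) = u := by
    rcases (show 1 < B ∨ B = 1 by omega) with h | rfl
    · rw [show u + 2 * k = 2 * k * 1 + u by ring]
      exact blockOffset_long hk (by omega) h hu (by omega)
    · rw [show u + 2 * k = 2 * k * 1 + ((2 * k - 1) * 0 + u) by ring]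
      exact blockOffset_short hk (by omega) le_rfl (by omega) hu (by omega)
  have h3 : blockOffset k B (u - (2 * k - 1)) = u := by
    rw [show u - (2 * k - 1) = 2 * k * B + ((2 * k - 1) * (k - 2) + u) + circumference k B * (-1) by
      unfold circumference; ring, blockOffset_add_mul]
    exact blockOffset_short hk (by omega) (by omega) (by omega) hu (by omega)
  simp only [IsBlockZero, h1, h2, h3, hue, huk, and_self]

/-- The zeros of the first long block are recognised by the zeros at distance `2k` after them and
`2k - 1` before them. -/
lemma exists_eq_of_isBlockZero (hk : 2 ≤ k) (hB : 1 ≤ B) {y : ℤ} (h1 : IsBlockZero k B y)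
    (h2 : IsBlockZero k B (y + 2 * k)) (h3 : IsBlockZero k B (y - (2 * k - 1))) :
    ∃ u j : ℤ, 0 ≤ u ∧ u ≤ k - 2 ∧ y = u + circumference k B * j := by
  obtain ⟨j, q, u, hq, hu, ⟨hq', hu', rfl⟩ | ⟨hq', hu', rfl⟩⟩ := exists_block hk hB y
  · rw [isBlockZero_add_mul, IsBlockZero, blockOffset_long hk hq hq' hu hu'] at h1
    rcases hq.eq_or_lt with rfl | hq
    · exact ⟨u, j, hu, h1.2, by ring⟩
    · rw [show 2 * k * q + u + circumference k B * j - (2 * k - 1) =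
        2 * k * (q - 1) + (u + 1) + circumference k B * j by ring, isBlockZero_add_mul,
        IsBlockZero, blockOffset_long hk (by omega) (by omega) (by omega) (by omega)] at h3
      exact absurd h3.1 (by simpa [Int.even_add_one] using h1.1)
  · exfalso
    rw [isBlockZero_add_mul, IsBlockZero, blockOffset_short hk (by omega) hq hq' hu hu'] at h1
    have h4 : blockOffset k B
        (2 * k * B + ((2 * k - 1) * q + u) + circumference k B * j + 2 * k) = u + 1 := by
      rcases (show q + 1 < k - 1 ∨ k = q + 2 by omega) with h | rfl
      · rw [show 2 * k * B + ((2 * k - 1) * q + u) + circumference k B * j + 2 * k =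
          2 * k * B + ((2 * k - 1) * (q + 1) + (u + 1)) + circumference k B * j by ring,
          blockOffset_add_mul]
        exact blockOffset_short hk (by omega) (by omega) h (by omega) (by omega)
      · rw [show 2 * (q + 2) * B + ((2 * (q + 2) - 1) * q + u) + circumference (q + 2) B * j +
            2 * (q + 2) = 2 * (q + 2) * 0 + (u + 1) + circumference (q + 2) B * (j + 1) by
          unfold circumference; ring, blockOffset_add_mul]
        exact blockOffset_long hk le_rfl (by omega) (by omega) (by omega)
    rw [IsBlockZero, h4] at h2
    exact absurd h2.1 (by simpa [Int.even_add_one] using h1.1)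

/-- The block zeros have no rotational symmetry. -/
lemma circumference_dvd_of_isBlockZero_add (hk : 2 ≤ k) (hke : Even k) (hB : 1 ≤ B) {d : ℤ}
    (hd : ∀ y, IsBlockZero k B (y + d) ↔ IsBlockZero k B y) : circumference k B ∣ d := by
  have shift {u : ℤ} (hu : 0 ≤ u) (hue : Even u) (huk : u ≤ k - 2) :
      ∃ v j : ℤ, 0 ≤ v ∧ v ≤ k - 2 ∧ u + d = v + circumference k B * j := by
    obtain ⟨h1, h2, h3⟩ := isBlockZero_of_mem_first hk hB hu hue huk
    refine exists_eq_of_isBlockZero hk hB ((hd u).2 h1) ?_ ?_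
    · rw [add_right_comm]; exact (hd _).2 h2
    · rw [add_sub_right_comm]; exact (hd _).2 h3
  obtain ⟨v, i, hv, hvk, hvi⟩ := shift le_rfl (by simp) (by omega)
  obtain ⟨w, j, hw, hwk, hwj⟩ := shift (u := k - 2) (by omega) (hke.sub even_two) le_rfl
  have hP : 2 * k ≤ circumference k B := by unfold circumference; nlinarith
  have hij : circumference k B * (j - i) = k - 2 + v - w := by linarith
  have hji : j - i = 0 := by
    by_contra hne
    rcases (show j - i ≤ -1 ∨ 1 ≤ j - i by omega) with h | h <;> nlinarith
  rw [hji, mul_zero] at hij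
  exact ⟨i, by linarith [show v = 0 by omega]⟩


/-- The block zeros at the positions of the seed. -/
lemma isBlockZero_seed_iff (hk : 2 ≤ k) (hke : Even k) (hB : 1 ≤ B) {m : ℤ} (hm : 1 ≤ m)
    (hmB : m ≤ 2 * B + 2 * k - 2) :
    IsBlockZero k B (k * (-m) + (k - 2)) ↔ 4 ∣ m ∧ m ≤ 2 * k - 4 := by
  rw [← isBlockZero_add_mul _ 1, IsBlockZero]
  rw [Int.even_iff] at *
  rcases le_or_gt m (2 * k - 3) with h | h
  · obtain ⟨i, rfl | rfl⟩ := Int.even_or_odd' m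
    · rw [show k * (-(2 * i)) + (k - 2) + circumference k B * 1 =
          2 * k * B + ((2 * k - 1) * (k - 1 - i) + (k - 2 - i)) by unfold circumference; ring,
        blockOffset_short hk (by omega) (by omega) (by omega) (by omega) (by omega)]
      omega
    · rw [show k * (-(2 * i + 1)) + (k - 2) + circumference k B * 1 =
          2 * k * B + ((2 * k - 1) * (k - 2 - i) + (2 * k - 3 - i)) by unfold circumference; ring,
        blockOffset_short hk (by omega) (by omega) (by omega) (by omega) (by omega)]
      omega
  · obtain ⟨t, rfl⟩ : ∃ t, m = 2 * B + 2 * k - 2 - t := ⟨2 * B + 2 * k - 2 - m, by ring⟩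
    obtain ⟨i, rfl | rfl⟩ := Int.even_or_odd' t
    · rcases (show i = 0 ∨ 1 ≤ i by omega) with rfl | hi
      · rw [show k * (-(2 * B + 2 * k - 2 - 2 * 0)) + (k - 2) + circumference k B * 1 =
            2 * k * B + ((2 * k - 1) * (k - 2) + (2 * k - 2)) + circumference k B * (-1) by
          unfold circumference; ring, blockOffset_add_mul,
          blockOffset_short hk (by omega) (by omega) (by omega) (by omega) (by omega)]
        omega
      · rw [show k * (-(2 * B + 2 * k - 2 - 2 * i)) + (k - 2) + circumference k B * 1 =
            2 * k * (i - 1) + (2 * k - 1) by unfold circumference; ring,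
          blockOffset_long hk (by omega) (by omega) (by omega) (by omega)]
        omega
    · rw [show k * (-(2 * B + 2 * k - 2 - (2 * i + 1))) + (k - 2) + circumference k B * 1 =
          2 * k * i + (k - 1) by unfold circumference; ring,
        blockOffset_long hk (by omega) (by omega) (by omega) (by omega)]
      omega

end

open Classical in
lemma seed18_eq {n b : ℕ} {B x : ℤ} (hB : 1 ≤ B) (hb : (b : ℤ) = 2 * B + 4 * n + 1)
    (hx : x < 0) (hxb : -(b + 1 : ℤ) ≤ x) :
    seed18 n x = if IsBlockZero (2 * n + 2) B ((2 * n + 2) * x + 2 * n) then 0 else 1 := by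
  have h := isBlockZero_seed_iff (k := 2 * n + 2) (B := B) (m := -x) (by omega)
    ⟨n + 1, by ring⟩ hB (by omega) (by omega)
  rw [neg_neg, add_sub_cancel_right] at h
  rw [seed18]
  refine if_congr ?_ rfl rfl
  rw [h]
  constructor
  · rintro ⟨m, hm, hmn, rfl⟩
    omega
  · rintro ⟨⟨c, hc⟩, hn⟩
    exact ⟨c.toNat, by omega, by omega, by omega⟩

open Classical in
/-- The winning sequence reads off the block zeros along the progression of difference
`2n + 2`. -/
lemma W_seed18_eq {n b : ℕ} {B : ℤ} (hB : 1 ≤ B) (hb : (b : ℤ) = 2 * B + 4 * n + 1)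
    (x : ℤ) (hx : -(b + 1 : ℤ) ≤ x) :
    W {1, b, b + 1} (seed18 n) x =
      if IsBlockZero (2 * n + 2) B ((2 * n + 2) * x + 2 * n) then 0 else 1 := by
  induction h : (x + (b + 1)).toNat using Nat.strong_induction_on generalizing x with
  | _ N ih =>
    rcases lt_or_ge x 0 with hx0 | hx0
    · rw [W, if_neg (by omega), seed18_eq hB hb hx0 hx]
    have ih' (a : ℤ) (ha : 1 ≤ a) (hab : a ≤ b + 1) :
        W {1, b, b + 1} (seed18 n) (x - a) = 0 ↔
          IsBlockZero (2 * n + 2) B ((2 * n + 2) * (x - a) + 2 * n) := by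
      rw [ih _ (by omega) (x - a) (by omega) rfl]
      split_ifs <;> simp [*]
    have hrec := isBlockZero_iff (k := 2 * n + 2) (B := B) (by omega) ⟨n + 1, by ring⟩ hB
      ((2 * n + 2) * x + 2 * n)
    have e2 : ((2 * n + 2) * x + 2 * n + 1 : ℤ) =
        (2 * n + 2) * (x - b) + 2 * n + circumference (2 * n + 2) B * 1 := by
      rw [hb]; unfold circumference; ring
    have e3 : ((2 * n + 2) * x + 2 * n - (2 * n + 2 - 1) : ℤ) =
        (2 * n + 2) * (x - (b + 1)) + 2 * n + circumference (2 * n + 2) B * 1 := by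
      rw [hb]; unfold circumference; ring
    rw [show ((2 * n + 2) * x + 2 * n - (2 * n + 2) : ℤ) = (2 * n + 2) * (x - 1) + 2 * n by ring,
      e2, e3, isBlockZero_add_mul, isBlockZero_add_mul, ← ih' 1 le_rfl (by omega),
      ← ih' b (by omega) (by omega), ← ih' (b + 1) (by omega) le_rfl] at hrec
    rw [W_eq_of_nonneg _ _ (by rintro a (rfl | rfl | rfl) <;> omega) hx0]
    simp only [Set.mem_insert_iff, Set.mem_singleton_iff, exists_eq_or_imp, exists_eq_left,
      Nat.cast_one, Nat.cast_add]
    split_ifs <;> first | rfl | tauto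

/-- for odd `b > 4n + 1` and `A = {1, b, b+1}` with the seed
`(0111)^n`, `per(A,S) = 2(n+1)b + 1` and `preper(A,S) = 0`. -/
theorem stmt_18 (n b : ℕ) (hb : Odd b) (hbn : 4 * n + 1 < b) :
    per (W {1, b, b + 1} (seed18 n)) = 2 * (n + 1) * b + 1 ∧
    preper (W {1, b, b + 1} (seed18 n)) = 0 := by
  classical
  obtain ⟨B, hB, hbB⟩ : ∃ B : ℤ, 1 ≤ B ∧ (b : ℤ) = 2 * B + 4 * n + 1 := by
    obtain ⟨c, rfl⟩ := hb
    exact ⟨c - 2 * n, by omega, by push_cast; ring⟩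
  have hW := W_seed18_eq hB hbB
  have hP : ((2 * (n + 1) * b + 1 : ℕ) : ℤ) = circumference (2 * n + 2) B := by
    push_cast; rw [hbB]; unfold circumference; ring
  have hperiodic (x : ℤ) (hx : 0 ≤ x) : W {1, b, b + 1} (seed18 n) x =
      W {1, b, b + 1} (seed18 n) (x + (2 * (n + 1) * b + 1 : ℕ)) := by
    rw [hW x (by omega), hW _ (by omega), hP,
      show ((2 * n + 2) * (x + circumference (2 * n + 2) B) + 2 * n : ℤ) =
        (2 * n + 2) * x + 2 * n + circumference (2 * n + 2) B * (2 * n + 2) by ring]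
    simp only [isBlockZero_add_mul]
  have hper : per (W {1, b, b + 1} (seed18 n)) = 2 * (n + 1) * b + 1 := by
    refine le_antisymm (Nat.sInf_le ⟨by omega, 0, hperiodic⟩)
      (le_csInf ⟨_, by omega, 0, hperiodic⟩ ?_)
    rintro p ⟨hp, N, hN⟩
    have hd : circumference (2 * n + 2) B ∣ (2 * n + 2) * p := by
      refine circumference_dvd_of_isBlockZero_add (by omega) ⟨n + 1, by ring⟩ hB fun y => ?_
      obtain ⟨x, j, hx, hxy⟩ : ∃ x j : ℤ, N ≤ x ∧
          (2 * n + 2) * x + 2 * n = y + circumference (2 * n + 2) B * j := by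
        set c : ℤ := (2 * n - y) * b
        refine ⟨c + circumference (2 * n + 2) B * (N + |c|),
          2 * n - y + (2 * n + 2) * (N + |c|), ?_, ?_⟩
        · have := neg_abs_le c
          have h1 : 1 ≤ circumference (2 * n + 2) B := circumference_pos (by omega) hB
          nlinarith [abs_nonneg c]
        · rw [← hP]; simp only [c]; push_cast; ring
      have h := hN x hx
      rw [hW x (by omega), hW _ (by omega), mul_add, add_right_comm, hxy] at h
      rw [← isBlockZero_add_mul y j, ← isBlockZero_add_mul (y + _) j, add_right_comm]
      split_ifs at h <;> simp_all
    have hcop : IsCoprime (circumference (2 * n + 2) B) (2 * n + 2) :=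
      ⟨1, -b, by rw [← hP]; push_cast; ring⟩
    have := Int.le_of_dvd (by omega) (hcop.dvd_of_dvd_mul_left hd)
    omega
  refine ⟨hper, Nat.sInf_eq_zero.2 (.inl ?_)⟩
  rw [Set.mem_ofPred_eq, hper]
  exact hperiodic
end

section
/- Let n ≥ 1, let b = 4n − 1, and let A = {n, n·b, n·b + n} (so max A = 4n²). Let S ∈ {0,1}^{4n²} be the seed determined by: for j < 0, w^{A,S}(j) = 0 if and only if j = i − 4kn for some integers i, k with 0 ≤ i ≤ n − 1 and 1 ≤ k ≤ i. Then for every i ∈ {0, …, n − 1}, the integer 2(i + 1)b + 1 divides per(A, S); consequently per(A, S) ≥ lcm{2(i + 1)(4n − 1) + 1 : 0 ≤ i ≤ n − 1}. -/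
open Classical in
/-- The seed of Statement 19: for `j < 0`, `w(j) = 0` iff `j = i - 4kn` with
`0 ≤ i ≤ n - 1` and `1 ≤ k ≤ i`. -/
noncomputable def seed19 (n : ℕ) : ℤ → ℕ := fun j =>
  if ∃ i k : ℕ, i ≤ n - 1 ∧ 1 ≤ k ∧ k ≤ i ∧ j = (i : ℤ) - 4 * (k : ℤ) * n then 0 else 1

/-- The local zero pattern of the `{1, b, b + 1}`-game, `b = 4n - 1`, inside the `r`-th block of
length `2b`, at offset `s`. -/
def BlockZero (n i r s : ℤ) : Prop :=
  (s % 2 = 0 ∧ 0 ≤ r ∧ s / 4 < n - i) ∨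
  (s % 4 = 2 ∧ n - i ≤ s / 4 ∧ s / 4 < n - i + r ∧ s / 4 < n) ∨
  (s % 4 = 1 ∧ n - i + r ≤ s / 4 ∧ n - i ≤ s / 4 ∧ s / 4 < n) ∨
  (s % 4 = 3 ∧ 2 * n - i - 1 ≤ s / 4 ∧ s / 4 < 2 * n - i + r ∧ s / 4 < 2 * n - 1) ∨
  (s % 4 = 2 ∧ 2 * n - i + r ≤ s / 4 ∧ 2 * n - i - 1 ≤ s / 4 ∧ s / 4 < 2 * n - 1)

theorem blockZero_zero (n i r a : ℤ) : BlockZero n i r (4 * a) ↔ 0 ≤ r ∧ a < n - i := by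
  unfold BlockZero
  omega

theorem blockZero_one (n i r a : ℤ) :
    BlockZero n i r (4 * a + 1) ↔ n - i + r ≤ a ∧ n - i ≤ a ∧ a < n := by
  unfold BlockZero
  omega

theorem blockZero_two (n i r a : ℤ) :
    BlockZero n i r (4 * a + 2) ↔
      (0 ≤ r ∧ a < n - i) ∨ (n - i ≤ a ∧ a < n - i + r ∧ a < n) ∨
        (2 * n - i + r ≤ a ∧ 2 * n - i - 1 ≤ a ∧ a < 2 * n - 1) := by
  unfold BlockZero
  omega

theorem blockZero_three (n i r a : ℤ) :
    BlockZero n i r (4 * a + 3) ↔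
      2 * n - i - 1 ≤ a ∧ a < 2 * n - i + r ∧ a < 2 * n - 1 := by
  unfold BlockZero
  omega

theorem exists_four_mul (s : ℤ) :
    ∃ a, s = 4 * a ∨ s = 4 * a + 1 ∨ s = 4 * a + 2 ∨ s = 4 * a + 3 :=
  ⟨s / 4, by omega⟩

section BlockZero

variable {n i r s : ℤ}

theorem blockZero_rec_start (hin : i < n) (hr : 0 ≤ r) (hri : r ≤ i) :
    BlockZero n i r 0 ∧ ¬ BlockZero n i (r - 1) (8 * n - 3) ∧
      ¬ BlockZero n i (r - 1) (4 * n - 1) ∧ ¬ BlockZero n i (r - 1) (4 * n - 2) := by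
  rw [show (0 : ℤ) = 4 * 0 by ring, show 8 * n - 3 = 4 * (2 * n - 1) + 1 by ring,
    show 4 * n - 1 = 4 * (n - 1) + 3 by ring, show 4 * n - 2 = 4 * (n - 1) + 2 by ring]
  simp only [blockZero_zero, blockZero_one, blockZero_two, blockZero_three]
  omega

theorem blockZero_rec_even (hin : i < n) (hr : 0 ≤ r) (hri : r ≤ i)
    (hs : 0 < s) (hs' : s < 4 * n - 1) :
    BlockZero n i r s ↔ ¬ BlockZero n i r (s - 1) ∧
      ¬ BlockZero n i (r - 1) (s + (4 * n - 1)) ∧ ¬ BlockZero n i (r - 1) (s + (4 * n - 2)) := by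
  obtain ⟨a, rfl | rfl | rfl | rfl⟩ := exists_four_mul s
  · rw [show 4 * a - 1 = 4 * (a - 1) + 3 by ring,
      show 4 * a + (4 * n - 1) = 4 * (a + n - 1) + 3 by ring,
      show 4 * a + (4 * n - 2) = 4 * (a + n - 1) + 2 by ring]
    simp only [blockZero_zero, blockZero_two, blockZero_three]
    omega
  · rw [show 4 * a + 1 - 1 = 4 * a by ring,
      show 4 * a + 1 + (4 * n - 1) = 4 * (a + n) by ring,
      show 4 * a + 1 + (4 * n - 2) = 4 * (a + n - 1) + 3 by ring]
    simp only [blockZero_zero, blockZero_one, blockZero_three]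
    omega
  · rw [show 4 * a + 2 - 1 = 4 * a + 1 by ring,
      show 4 * a + 2 + (4 * n - 1) = 4 * (a + n) + 1 by ring,
      show 4 * a + 2 + (4 * n - 2) = 4 * (a + n) by ring]
    simp only [blockZero_zero, blockZero_one, blockZero_two]
    omega
  · rw [show 4 * a + 3 - 1 = 4 * a + 2 by ring,
      show 4 * a + 3 + (4 * n - 1) = 4 * (a + n) + 2 by ring,
      show 4 * a + 3 + (4 * n - 2) = 4 * (a + n) + 1 by ring]
    simp only [blockZero_one, blockZero_two, blockZero_three]
    omega

theorem blockZero_rec_odd (hin : i < n) (hr : 0 ≤ r) (hri : r ≤ i)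
    (hs : 4 * n - 1 < s) (hs' : s < 8 * n - 2) :
    BlockZero n i r s ↔ ¬ BlockZero n i r (s - 1) ∧
      ¬ BlockZero n i r (s - (4 * n - 1)) ∧ ¬ BlockZero n i r (s - 4 * n) := by
  obtain ⟨a, rfl | rfl | rfl | rfl⟩ := exists_four_mul s
  · rw [show 4 * a - 1 = 4 * (a - 1) + 3 by ring,
      show 4 * a - (4 * n - 1) = 4 * (a - n) + 1 by ring,
      show 4 * a - 4 * n = 4 * (a - n) by ring]
    simp only [blockZero_zero, blockZero_one, blockZero_three]
    omega
  · rw [show 4 * a + 1 - 1 = 4 * a by ring,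
      show 4 * a + 1 - (4 * n - 1) = 4 * (a - n) + 2 by ring,
      show 4 * a + 1 - 4 * n = 4 * (a - n) + 1 by ring]
    simp only [blockZero_zero, blockZero_one, blockZero_two]
    omega
  · rw [show 4 * a + 2 - 1 = 4 * a + 1 by ring,
      show 4 * a + 2 - (4 * n - 1) = 4 * (a - n) + 3 by ring,
      show 4 * a + 2 - 4 * n = 4 * (a - n) + 2 by ring]
    simp only [blockZero_one, blockZero_two, blockZero_three]
    omega
  · rw [show 4 * a + 3 - 1 = 4 * a + 2 by ring,
      show 4 * a + 3 - (4 * n - 1) = 4 * (a - n + 1) by ring,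
      show 4 * a + 3 - 4 * n = 4 * (a - n) + 3 by ring]
    simp only [blockZero_zero, blockZero_two, blockZero_three]
    omega

/-- Inside a block, gaps between zeros are at most `4` except for the one that starts in the
last zero of its first half. -/
theorem blockZero_gap_le_four (hin : i < n) (hr : 0 ≤ r) (hri : r ≤ i) (hs : 0 ≤ s)
    (hs' : s + 4 < 8 * n - 2) (h : BlockZero n i r s) (h2 : ¬ BlockZero n i r (s + 2))
    (h3 : ¬ BlockZero n i r (s + 3)) (h4 : ¬ BlockZero n i r (s + 4)) :
    4 * n - 3 ≤ s ∧ s ≤ 4 * n - 2 := by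
  obtain ⟨a, rfl | rfl | rfl | rfl⟩ := exists_four_mul s <;>
  grind (splits := 40) [BlockZero]

theorem blockZero_middle_gap (hin : i < n) (hr : 0 ≤ r) (hri : r ≤ i)
    (hs : 4 * n - 3 ≤ s) (hs' : s ≤ 4 * n - 2) (h : BlockZero n i r s)
    (h' : BlockZero n i r (s + (4 * n - 4 * i + 1))) : r = i ∧ s = 4 * n - 2 := by
  obtain rfl | rfl : s = 4 * (n - 1) + 1 ∨ s = 4 * (n - 1) + 2 := by omega
  · rw [show 4 * (n - 1) + 1 + (4 * n - 4 * i + 1) = 4 * (2 * n - i - 1) + 2 by ring] at h'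
    rw [blockZero_one] at h
    rw [blockZero_two] at h'
    omega
  · rw [show 4 * (n - 1) + 2 + (4 * n - 4 * i + 1) = 4 * (2 * n - i - 1) + 3 by ring] at h'
    rw [blockZero_two] at h
    rw [blockZero_three] at h'
    omega

end BlockZero

/-- The period `2(i + 1)b + 1`, `b = 4n - 1`. -/
def blockPeriod (n i : ℤ) : ℤ := (8 * n - 2) * (i + 1) + 1

/-- The zero set of the `{1, b, b + 1}`-game with seed zeros at `-4, -8, …, -4i`, extended
periodically to `ℤ`. -/
def GameZero (n i m : ℤ) : Prop :=
  m % blockPeriod n i ≠ blockPeriod n i - 1 ∧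
    BlockZero n i (m % blockPeriod n i / (8 * n - 2)) (m % blockPeriod n i % (8 * n - 2))

section GameZero

variable {n i : ℤ}

theorem blockPeriod_pos (hi : 0 ≤ i) (hin : i < n) : 0 < blockPeriod n i := by
  unfold blockPeriod
  nlinarith

theorem gameZero_add_mul (m k : ℤ) :
    GameZero n i (m + k * blockPeriod n i) ↔ GameZero n i m := by
  simp [GameZero]

theorem gameZero_block (hi : 0 ≤ i) (hin : i < n) {m k r s : ℤ} (hr : 0 ≤ r) (hri : r ≤ i)
    (hs : 0 ≤ s) (hs' : s < 8 * n - 2)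
    (hm : m = s + (8 * n - 2) * r + k * blockPeriod n i) :
    GameZero n i m ↔ BlockZero n i r s := by
  have h0 : 0 ≤ (8 * n - 2) * r := mul_nonneg (by omega) hr
  have h1 : (8 * n - 2) * r ≤ (8 * n - 2) * i := mul_le_mul_of_nonneg_left hri (by omega)
  have hP : blockPeriod n i = (8 * n - 2) * i + (8 * n - 2) + 1 := by
    unfold blockPeriod
    ring
  rw [hm, gameZero_add_mul]
  have hmod : (s + (8 * n - 2) * r) % blockPeriod n i = s + (8 * n - 2) * r :=
    Int.emod_eq_of_lt (by omega) (by omega)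
  unfold GameZero
  rw [hmod, Int.add_mul_ediv_left _ _ (by omega), Int.add_mul_emod_self_left,
    Int.ediv_eq_zero_of_lt hs hs', Int.emod_eq_of_lt hs hs', zero_add]
  exact and_iff_right (by omega)

theorem not_gameZero_last (hi : 0 ≤ i) (hin : i < n) {m k : ℤ}
    (hm : m = -1 + k * blockPeriod n i) : ¬ GameZero n i m := by
  have hP := blockPeriod_pos hi hin
  rw [hm, gameZero_add_mul]
  refine fun h => h.1 ?_
  rw [← Int.add_emod_right, Int.emod_eq_of_lt (by omega) (by omega)]
  ring

/-- The block preceding a period start follows the pattern with `r = -1`. -/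
theorem gameZero_prev (hi : 0 ≤ i) (hin : i < n) {m k s : ℤ}
    (hs : 4 * n - 2 ≤ s) (hs' : s < 8 * n - 2)
    (hm : m = s - (8 * n - 2) + k * blockPeriod n i) :
    GameZero n i m ↔ BlockZero n i (-1) s := by
  rcases eq_or_lt_of_le (show s ≤ 8 * n - 3 by omega) with h | h
  · have := not_gameZero_last hi hin (m := m) (k := k) (by rw [hm]; congr 1; omega)
    simp only [this, false_iff]
    unfold BlockZero
    omega
  · rw [gameZero_block hi hin (r := i) (s := s + 1) (k := k - 1) hi le_rfl (by omega) (by omega)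
      (by rw [hm]; unfold blockPeriod; ring)]
    unfold BlockZero
    omega

theorem exists_block_s19 (hi : 0 ≤ i) (hin : i < n) (m : ℤ) :
    (∃ k r s : ℤ, 0 ≤ r ∧ r ≤ i ∧ 0 ≤ s ∧ s < 8 * n - 2 ∧
      m = s + (8 * n - 2) * r + k * blockPeriod n i) ∨
    ∃ k : ℤ, m = -1 + k * blockPeriod n i := by
  have hP := blockPeriod_pos hi hin
  have h1 := Int.emod_add_mul_ediv m (blockPeriod n i)
  have h2 := Int.emod_nonneg m hP.ne'
  have h3 := Int.emod_lt_of_pos m hP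
  set u := m % blockPeriod n i
  by_cases hu : u = blockPeriod n i - 1
  · refine .inr ⟨m / blockPeriod n i + 1, ?_⟩
    linear_combination -h1 + hu
  · have h4 := Int.emod_add_mul_ediv u (8 * n - 2)
    refine .inl ⟨m / blockPeriod n i, u / (8 * n - 2), u % (8 * n - 2),
      Int.ediv_nonneg h2 (by omega), ?_, Int.emod_nonneg _ (by omega),
      Int.emod_lt_of_pos _ (by omega), by linear_combination -h1 - h4⟩
    have : u / (8 * n - 2) < i + 1 := by
      apply Int.ediv_lt_of_lt_mul (by omega)
      have : blockPeriod n i = (i + 1) * (8 * n - 2) + 1 := by unfold blockPeriod; ring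
      omega
    omega

theorem gameZero_rec (hi : 0 ≤ i) (hin : i < n) (m : ℤ) :
    GameZero n i m ↔
      ¬ GameZero n i (m - 1) ∧ ¬ GameZero n i (m - (4 * n - 1)) ∧ ¬ GameZero n i (m - 4 * n) := by
  rcases exists_block_s19 hi hin m with ⟨k, r, s, hr, hri, hs, hs', hm⟩ | ⟨k, hm⟩
  · rw [gameZero_block hi hin hr hri hs hs' hm]
    have prev : ∀ t : ℤ, 4 * n - 2 ≤ t → t < 8 * n - 2 → ∀ m', m' = m - s + t - (8 * n - 2) →
        (GameZero n i m' ↔ BlockZero n i (r - 1) t) := by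
      intro t ht ht' m' hm'
      rcases eq_or_lt_of_le hr with rfl | hr0
      · exact gameZero_prev hi hin (k := k) ht ht' (by rw [hm', hm]; ring)
      · exact gameZero_block hi hin (k := k) (by omega) (by omega) (by omega) ht'
          (by rw [hm', hm]; ring)
    have same : ∀ t : ℤ, 0 ≤ t → t < 8 * n - 2 → ∀ m', m' = m - s + t →
        (GameZero n i m' ↔ BlockZero n i r t) := fun t ht ht' m' hm' =>
      gameZero_block hi hin (k := k) hr hri ht ht' (by rw [hm', hm]; ring)
    rcases lt_trichotomy s (4 * n - 1) with h | h | h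
    · rcases eq_or_lt_of_le hs with rfl | h0
      · rw [prev (8 * n - 3) (by omega) (by omega) (m - 1) (by omega),
          prev (4 * n - 1) (by omega) (by omega) (m - (4 * n - 1)) (by ring),
          prev (4 * n - 2) (by omega) (by omega) (m - 4 * n) (by ring)]
        obtain ⟨h1, h2⟩ := blockZero_rec_start hin hr hri
        exact iff_of_true h1 h2
      · rw [same (s - 1) (by omega) (by omega) (m - 1) (by ring),
          prev (s + (4 * n - 1)) (by omega) (by omega) (m - (4 * n - 1)) (by ring),
          prev (s + (4 * n - 2)) (by omega) (by omega) (m - 4 * n) (by ring)]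
        exact blockZero_rec_even hin hr hri h0 h
    · rw [same (s - 1) (by omega) (by omega) (m - 1) (by ring),
        same 0 (by omega) (by omega) (m - (4 * n - 1)) (by omega)]
      have h1 : ¬ BlockZero n i r s := by unfold BlockZero; omega
      have h2 : BlockZero n i r 0 := by unfold BlockZero; omega
      exact iff_of_false h1 fun h => h.2.1 h2
    · rw [same (s - 1) (by omega) (by omega) (m - 1) (by ring),
        same (s - (4 * n - 1)) (by omega) (by omega) (m - (4 * n - 1)) (by ring),
        same (s - 4 * n) (by omega) (by omega) (m - 4 * n) (by ring)]
      exact blockZero_rec_odd hin hr hri h hs'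
  · have h1 := not_gameZero_last hi hin hm
    have h2 : GameZero n i (m - 4 * n) := by
      rw [gameZero_block hi hin (r := i) (s := 4 * n - 2) (k := k - 1) hi le_rfl (by omega)
        (by omega) (by rw [hm]; unfold blockPeriod; ring)]
      unfold BlockZero
      omega
    exact iff_of_false h1 fun h => h.2.2 h2

theorem gameZero_seed (hi : 0 ≤ i) (hin : i < n) {m : ℤ} (hm : -(4 * n) ≤ m) (hm' : m < 0) :
    GameZero n i m ↔ ∃ k : ℤ, 1 ≤ k ∧ k ≤ i ∧ m = -(4 * k) := by
  rw [gameZero_prev hi hin (s := m + (8 * n - 2)) (k := 0) (by omega) (by omega) (by ring)]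
  unfold BlockZero
  refine ⟨fun h => ⟨-m / 4, ?_⟩, ?_⟩
  · omega
  · rintro ⟨k, h1, h2, rfl⟩
    omega

/-- The gap of length `4(n - i) + 1` occurs only once per period. -/
theorem gap_unique (hi : 0 ≤ i) (hin : i < n) {y : ℤ} (h0 : GameZero n i y)
    (h1 : ∀ d, 1 ≤ d → d ≤ 4 * n - 4 * i → ¬ GameZero n i (y + d))
    (h2 : GameZero n i (y + (4 * n - 4 * i + 1))) :
    ∃ k : ℤ, y = 4 * n - 2 + (8 * n - 2) * i + k * blockPeriod n i := by
  rcases exists_block_s19 hi hin y with ⟨k, r, s, hr, hri, hs, hs', hy⟩ | ⟨k, hy⟩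
  · rw [gameZero_block hi hin hr hri hs hs' hy] at h0
    have same : ∀ d : ℤ, 0 ≤ d → s + d < 8 * n - 2 →
        (GameZero n i (y + d) ↔ BlockZero n i r (s + d)) := fun d hd hd' =>
      gameZero_block hi hin (k := k) hr hri (by omega) hd' (by rw [hy]; ring)
    suffices r = i ∧ s = 4 * n - 2 by
      obtain ⟨rfl, rfl⟩ := this
      exact ⟨k, hy⟩
    by_contra hne
    by_cases hs1 : s + 4 < 8 * n - 2
    · have e2 := h1 2 (by omega) (by omega)
      have e3 := h1 3 (by omega) (by omega)
      have e4 := h1 4 (by omega) (by omega)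
      rw [same _ (by omega) (by omega)] at e2 e3 e4
      obtain ⟨hs2, hs3⟩ := blockZero_gap_le_four hin hr hri hs hs1 h0 e2 e3 e4
      rcases eq_or_lt_of_le hi with rfl | hi0
      · unfold BlockZero at h0
        omega
      rw [same _ (by omega) (by omega)] at h2
      exact hne (blockZero_middle_gap hin hr hri hs2 hs3 h0 h2)
    · rcases lt_or_eq_of_le hri with h | rfl
      · refine h1 (8 * n - 2 - s) (by omega) (by omega) ?_
        rw [gameZero_block hi hin (r := r + 1) (s := 0) (k := k) (by omega) (by omega) le_rfl
          (by omega) (by rw [hy]; ring)]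
        unfold BlockZero
        omega
      · refine h1 (8 * n - 1 - s) (by omega) (by unfold BlockZero at h0; omega) ?_
        rw [gameZero_block hi hin (r := 0) (s := 0) (k := k + 1) (by omega) (by omega) le_rfl
          (by omega) (by rw [hy]; unfold blockPeriod; ring)]
        unfold BlockZero
        omega
  · exact absurd h0 (not_gameZero_last hi hin hy)

theorem gap_exists (hi : 0 ≤ i) (hin : i < n) {y k : ℤ}
    (hy : y = 4 * n - 2 + (8 * n - 2) * i + k * blockPeriod n i) :
    GameZero n i y ∧ (∀ d, 1 ≤ d → d ≤ 4 * n - 4 * i → ¬ GameZero n i (y + d)) ∧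
      GameZero n i (y + (4 * n - 4 * i + 1)) := by
  have same : ∀ d : ℤ, 0 ≤ d → d < 4 * n →
      (GameZero n i (y + d) ↔ BlockZero n i i (4 * n - 2 + d)) := fun d hd hd' =>
    gameZero_block hi hin (k := k) hi le_rfl (by omega) (by omega) (by rw [hy]; ring)
  refine ⟨?_, fun d hd hd' => ?_, ?_⟩
  · rw [← add_zero y, same 0 le_rfl (by omega)]
    unfold BlockZero
    omega
  · by_cases h : d < 4 * n
    · rw [same d (by omega) h]
      unfold BlockZero
      omega
    · exact not_gameZero_last hi hin (k := k + 1) (by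
        rw [hy, show d = 4 * n by omega, show i = 0 by omega]; unfold blockPeriod; ring)
  · by_cases h : i = 0
    · rw [gameZero_block hi hin (r := 0) (s := 0) (k := k + 1) le_rfl hi le_rfl (by omega) (by
        rw [hy, h]; unfold blockPeriod; ring)]
      unfold BlockZero
      omega
    · rw [same _ (by omega) (by omega)]
      unfold BlockZero
      omega

/-- Every eventual period of `GameZero n i` is a multiple of `blockPeriod n i`. -/
theorem blockPeriod_dvd (hi : 0 ≤ i) (hin : i < n) {p N : ℤ}
    (h : ∀ m, N ≤ m → (GameZero n i (m + p) ↔ GameZero n i m)) : blockPeriod n i ∣ p := by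
  have hP := blockPeriod_pos hi hin
  have hN : N ≤ |N| * blockPeriod n i :=
    (le_abs_self N).trans (le_mul_of_one_le_right (abs_nonneg N) hP)
  have hq : 0 ≤ (8 * n - 2) * i := mul_nonneg (by omega) hi
  obtain ⟨a0, a1, a2⟩ := gap_exists hi hin (k := |N|) rfl
  set y := 4 * n - 2 + (8 * n - 2) * i + |N| * blockPeriod n i with hy
  obtain ⟨k, hk⟩ := gap_unique hi hin (y := y + p) ((h y (by omega)).2 a0)
    (fun d hd hd' => by
      rw [add_right_comm, h _ (by omega)]
      exact a1 d hd hd')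
    (by rw [add_right_comm, h _ (by omega)]; exact a2)
  exact ⟨k - |N|, by linear_combination hk - hy⟩

end GameZero

theorem W_of_neg (A : Set ℕ) (seed : ℤ → ℕ) {m : ℤ} (hm : m < 0) : W A seed m = seed m :=
  if_neg (by omega)

open Classical in
theorem W_of_nonneg {A : Set ℕ} (hA : ∀ x ∈ A, 0 < x) (seed : ℤ → ℕ) {m : ℤ} (hm : 0 ≤ m) :
    W A seed m = if ∃ x ∈ A, W A seed (m - x) = 0 then 1 else 0 := by
  lift m to ℕ using hm
  rw [W, if_pos (by omega), Int.toNat_natCast, subW, Nat.strongRecOn_eq]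
  refine if_congr (exists_congr fun x => and_congr_right fun hx => ?_) rfl rfl
  have h0 := hA x hx
  by_cases h : x ≤ m
  · rw [dif_pos ⟨h0, h⟩, W, if_pos (by omega), show ((m : ℤ) - x).toNat = m - x by omega]
    rfl
  · rw [dif_neg (by omega), W_of_neg _ _ (by omega)]

theorem W_eq_zero_or_one {A : Set ℕ} (hA : ∀ x ∈ A, 0 < x) (seed : ℤ → ℕ) {m : ℤ}
    (hm : 0 ≤ m) : W A seed m = 0 ∨ W A seed m = 1 := by
  rw [W_of_nonneg hA seed hm]
  split_ifs <;> simp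

/-- The subtraction set of the theorem. -/
abbrev moves (n : ℕ) : Set ℕ := {n, n * (4 * n - 1), n * (4 * n - 1) + n}

theorem moves_pos {n : ℕ} (hn : 1 ≤ n) : ∀ x ∈ moves n, 0 < x := by
  have : 0 < n * (4 * n - 1) := Nat.mul_pos hn (by omega)
  rintro x (rfl | rfl | rfl) <;> omega

theorem W_seed19_eq_zero_iff {n i : ℕ} (hin : i < n) (m : ℤ) (hm : -(4 * n : ℤ) ≤ m) :
    W (moves n) (seed19 n) (i + n * m) = 0 ↔ GameZero n i m := by
  have hn : 1 ≤ n := by omega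
  by_cases hneg : m < 0
  · have hlt : (i : ℤ) + n * m < 0 := by nlinarith
    rw [W_of_neg _ _ hlt, gameZero_seed (by omega) (by omega) hm hneg, seed19]
    simp only [ite_eq_left_iff, one_ne_zero, imp_false, not_not]
    constructor
    · rintro ⟨i', k, h1, h2, h3, h4⟩
      have hdvd : (i' : ℤ) = i := by
        have h5 : ((i : ℤ) + n * m) % n = i := by
          rw [Int.add_mul_emod_self_left, Int.emod_eq_of_lt (by omega) (by omega)]
        rw [h4, show (i' : ℤ) - 4 * k * n = i' + n * (-(4 * k)) by ring,
          Int.add_mul_emod_self_left, Int.emod_eq_of_lt (by omega) (by omega)] at h5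
        exact h5
      refine ⟨k, by omega, by omega, ?_⟩
      have h6 : (n : ℤ) * m = n * (-(4 * k)) := by linear_combination h4 + hdvd
      exact mul_left_cancel₀ (by omega) h6
    · rintro ⟨k, h1, h2, rfl⟩
      lift k to ℕ using by omega
      exact ⟨i, k, by omega, by omega, by omega, by ring⟩
  · have hnm : (0 : ℤ) ≤ n * m := mul_nonneg (by omega) (by omega)
    have hb : ((n * (4 * n - 1) : ℕ) : ℤ) = n * (4 * n - 1) := by
      rw [Nat.cast_mul, Nat.cast_sub (by omega)]
      push_cast
      ring
    rw [W_of_nonneg (moves_pos hn) _ (by omega), gameZero_rec (by omega) (by omega),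
      ← W_seed19_eq_zero_iff hin (m - 1) (by omega),
      ← W_seed19_eq_zero_iff hin (m - (4 * n - 1)) (by omega),
      ← W_seed19_eq_zero_iff hin (m - 4 * n) (by omega)]
    simp only [moves, Set.mem_insert_iff, Set.mem_singleton_iff, exists_eq_or_imp, exists_eq_left,
      Nat.cast_add, hb]
    rw [show (i : ℤ) + n * m - n = i + n * (m - 1) by ring,
      show (i : ℤ) + n * m - n * (4 * n - 1) = i + n * (m - (4 * n - 1)) by ring,
      show (i : ℤ) + n * m - (n * (4 * n - 1) + n) = i + n * (m - 4 * n) by ring]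
    split_ifs with h
    · simp only [false_iff]
      tauto
    · simp only [true_iff]
      tauto
termination_by (m + 4 * n).toNat

theorem natCast_blockPeriod {n : ℕ} (hn : 1 ≤ n) (i : ℕ) :
    ((2 * (i + 1) * (4 * n - 1) + 1 : ℕ) : ℤ) = blockPeriod n i := by
  have : ((4 * n - 1 : ℕ) : ℤ) = 4 * n - 1 := by omega
  push_cast [this]
  unfold blockPeriod
  ring

theorem dvd_of_periodicOver {n i p : ℕ} (hin : i < n)
    (hp : PeriodicOver (W (moves n) (seed19 n)) p) : 2 * (i + 1) * (4 * n - 1) + 1 ∣ p := by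
  obtain ⟨N, hN⟩ := hp
  have hmul : ∀ (q : ℕ) (m : ℤ), (N : ℤ) ≤ m →
      W (moves n) (seed19 n) (m + q * p) = W (moves n) (seed19 n) m := by
    intro q m hm
    induction q with
    | zero => simp
    | succ q ih =>
      rw [← ih, hN (m + q * p) (hm.trans (le_add_of_nonneg_right (by positivity)))]
      congr 1
      push_cast
      ring
  rw [← Int.natCast_dvd_natCast, natCast_blockPeriod (by omega)]
  refine blockPeriod_dvd (N := N) (by omega) (by omega) fun m hm => ?_
  rw [← W_seed19_eq_zero_iff hin _ (by omega), ← W_seed19_eq_zero_iff hin _ (by omega),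
    ← hmul n (i + n * m) (by nlinarith)]
  rw [mul_add, add_assoc]

theorem exists_periodicOver {n : ℕ} (hn : 1 ≤ n) :
    ∃ p : ℕ, 0 < p ∧ PeriodicOver (W (moves n) (seed19 n)) p := by
  refine ⟨n * ∏ i ∈ Finset.range n, (2 * (i + 1) * (4 * n - 1) + 1),
    Nat.mul_pos hn (Finset.prod_pos fun i _ => by omega), 0, fun m hm => ?_⟩
  obtain ⟨i, hi⟩ := Int.eq_ofNat_of_zero_le (Int.emod_nonneg m (show (n : ℤ) ≠ 0 by omega))
  have hin : i < n := by
    have := Int.emod_lt_of_pos m (show (0 : ℤ) < n by omega)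
    omega
  obtain ⟨k, hk⟩ := Finset.dvd_prod_of_mem (fun i => 2 * (i + 1) * (4 * n - 1) + 1)
    (Finset.mem_range.2 hin)
  have hm0 : 0 ≤ m / n := Int.ediv_nonneg hm (by omega)
  have hmq : m = i + n * (m / n) := by
    have := Int.emod_add_mul_ediv m n
    omega
  rw [hk]
  set P := 2 * (i + 1) * (4 * n - 1) + 1 with hP
  have key : W (moves n) (seed19 n) m = 0 ↔
      W (moves n) (seed19 n) (m + ((n * (P * k) : ℕ) : ℤ)) = 0 := by
    have hshift : m + ((n * (P * k) : ℕ) : ℤ) = i + n * (m / n + k * P) := by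
      push_cast
      linear_combination hmq
    have : (0 : ℤ) ≤ k * P := by positivity
    rw [hshift, W_seed19_eq_zero_iff hin _ (by omega), hP, natCast_blockPeriod hn,
      gameZero_add_mul, ← W_seed19_eq_zero_iff hin _ (by omega), ← hmq]
  have hle : 0 ≤ m + ((n * (P * k) : ℕ) : ℤ) := by omega
  have h1 := W_eq_zero_or_one (moves_pos hn) (seed19 n) hm
  have h2 := W_eq_zero_or_one (moves_pos hn) (seed19 n) hle
  omega

theorem periodicOver_per {w : ℤ → ℕ} (h : ∃ p : ℕ, 0 < p ∧ PeriodicOver w p) :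
    0 < per w ∧ PeriodicOver w (per w) :=
  Nat.sInf_mem h

/-- for `n ≥ 1`, `b = 4n - 1`, `A = {n, nb, nb + n}` with the seed
above, each `2(i+1)b + 1` (for `0 ≤ i ≤ n-1`) divides `per(A,S)`; hence
`per(A,S) ≥ lcm{2(i+1)(4n-1) + 1 : 0 ≤ i ≤ n-1}`. -/
theorem stmt_19 (n : ℕ) (hn : 1 ≤ n) :
    (∀ i : ℕ, i ≤ n - 1 →
      (2 * (i + 1) * (4 * n - 1) + 1)
        ∣ per (W {n, n * (4 * n - 1), n * (4 * n - 1) + n} (seed19 n))) ∧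
    (Finset.range n).lcm (fun i => 2 * (i + 1) * (4 * n - 1) + 1)
      ≤ per (W {n, n * (4 * n - 1), n * (4 * n - 1) + n} (seed19 n)) := by
  obtain ⟨hpos, hper⟩ := periodicOver_per (exists_periodicOver hn)
  have hdvd : ∀ i : ℕ, i ≤ n - 1 →
      (2 * (i + 1) * (4 * n - 1) + 1)
        ∣ per (W {n, n * (4 * n - 1), n * (4 * n - 1) + n} (seed19 n)) :=
    fun i hi => dvd_of_periodicOver (by omega) hper
  refine ⟨hdvd, Nat.le_of_dvd hpos (Finset.lcm_dvd fun i hi => hdvd i ?_)⟩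
  have := Finset.mem_range.1 hi
  omega
end
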